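/- Let $d\ge 1$, $0\le k\le d$ and $B\ge 1$ be integers, and let $L:\mathbb{R}^d\to\mathbb{R}$ be differentiable with $G$-Lipschitz gradient for some $G\ge 0$, i.e. $\|\nabla L(x)-\nabla L(y)\|\le G\|x-y\|$ for all $x,y\in\mathbb{R}^d$ (Euclidean norm). Let $C>0$, $\gamma>0$ and $\sigma\in\mathbb{R}$. On a common probability space, let $w$ and $\hat g$ be random vectors in $\mathbb{R}^d$ with $\|\hat g\|\le C$ almost surely; let $m$ be a random freeze mask with $k$ active coordinates, i.e. a random vector uniformly distributed over all vectors in $\{0,1\}^d$ having exactly $k$ coordinates equal to $1$; and let $\zeta\sim N(0,C^2\sigma^2 I_d)$ be independent of the triple $(w,\hat g,m)$. Put $r=1-k/d$ (the freeze rate) and $$w'=w-\gamma\Bigl(\hat g+\tfrac1B\, m\odot\zeta\Bigr),$$ where $\odot$ is the coordinatewise product, $\gamma$ is the learning rate and $B$ is the batch size. If $L(w)$, $L(w')$ and $\langle\nabla L(w),\hat g\rangle$ are integrable, then $$\mathbb{E}\bigl[\langle\nabla L(w),\hat g\rangle\bigr]\le\frac{\mathbb{E}[L(w)]-\mathbb{E}[L(w')]}{\gamma}+\frac{G\gamma}{2}\left(C^2+(1-r)\frac{C^2\sigma^2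 d}{B^2}\right).$$ -/

import Mathlib

open MeasureTheory ProbabilityTheory
open scoped NNReal

/-- The coordinatewise (Hadamard) product `u ⊙ v` on `ℝ^d`. -/
noncomputable def hadamardProd {d : ℕ} (u v : EuclideanSpace ℝ (Fin d)) :
    EuclideanSpace ℝ (Fin d) :=
  WithLp.toLp 2 fun i => u i * v i

/-- The freeze masks with `k` active coordinates: the vectors of `{0,1}^d` having exactly `k`
coordinates equal to `1`. -/
def freezeMasks (d k : ℕ) : Set (EuclideanSpace ℝ (Fin d)) :=
  {m | (∀ i, m i = 0 ∨ m i = 1) ∧ {i | m i = 1}.ncard = k}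

/-- The freeze rate `r = 1 - k / d`. -/
noncomputable def freezeRate (d k : ℕ) : ℝ := 1 - (k : ℝ) / (d : ℝ)

/-- One update step `w - γ (g + (1 / B) (m ⊙ z))` with learning rate `γ` and batch size `B`. -/
noncomputable def freezeUpdate {d : ℕ} (γ : ℝ) (B : ℕ) (w g m z : EuclideanSpace ℝ (Fin d)) :
    EuclideanSpace ℝ (Fin d) :=
  w - γ • (g + (1 / (B : ℝ)) • hadamardProd m z)

section Smoothness

variable {E : Type*} [NormedAddCommGroup E] [InnerProductSpace ℝ E] [CompleteSpace E]

/-- Two-sided quadratic bound for a function with Lipschitz gradient. -/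
theorem LipschitzWith.abs_sub_sub_inner_gradient_le {L : E → ℝ} {G : ℝ≥0}
    (hL : Differentiable ℝ L) (hG : LipschitzWith G (gradient L)) (x v : E) :
    |L (x + v) - L x - inner ℝ (gradient L x) v| ≤ G / 2 * ‖v‖ ^ 2 := by
  have hder (t : ℝ) : HasDerivAt (fun t : ℝ => L (x + t • v) - L x - t * inner ℝ (gradient L x) v)
      (inner ℝ (gradient L (x + t • v) - gradient L x) v) t := by
    have h1 : HasDerivAt (fun t : ℝ => x + t • v) v t := by
      simpa using ((hasDerivAt_id t).smul_const v).const_add x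
    have h2 := (hL (x + t • v)).hasGradientAt.hasFDerivAt.comp_hasDerivAt t h1
    have h3 := (h2.sub_const (L x)).sub
      ((hasDerivAt_id t).mul_const (inner ℝ (gradient L x) v))
    exact h3.congr_deriv (by simp [inner_sub_left])
  have hbd (t : ℝ) : HasDerivAt (fun t : ℝ => G / 2 * ‖v‖ ^ 2 * t ^ 2) (G * t * ‖v‖ ^ 2) t := by
    refine ((hasDerivAt_pow 2 t).const_mul (G / 2 * ‖v‖ ^ 2)).congr_deriv ?_
    simp only [Nat.cast_ofNat, Nat.add_one_sub_one, pow_one]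
    ring
  have key := image_norm_le_of_norm_deriv_right_le_deriv_boundary (a := 0) (b := 1)
    (fun t _ => (hder t).continuousAt.continuousWithinAt)
    (fun t _ => (hder t).hasDerivWithinAt) (by simp) hbd
    (fun t ht => by
      calc ‖inner ℝ (gradient L (x + t • v) - gradient L x) v‖
          ≤ ‖gradient L (x + t • v) - gradient L x‖ * ‖v‖ := norm_inner_le_norm _ _
        _ ≤ (G * ‖x + t • v - x‖) * ‖v‖ := by
            gcongr
            exact hG.norm_sub_le _ _
        _ = G * t * ‖v‖ ^ 2 := by
            rw [add_sub_cancel_left, norm_smul, Real.norm_of_nonneg ht.1]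
            ring)
    (Set.right_mem_Icc.2 zero_le_one)
  simpa using key

end Smoothness

section Symmetry

theorem map_neg_stdGaussian (E : Type*) [NormedAddCommGroup E] [InnerProductSpace ℝ E]
    [FiniteDimensional ℝ E] [MeasurableSpace E] [BorelSpace E] :
    (stdGaussian E).map (fun x => -x) = stdGaussian E :=
  stdGaussian_map (LinearIsometryEquiv.neg ℝ)

theorem map_neg_multivariateGaussian_zero {ι : Type*} [Fintype ι] [DecidableEq ι]
    (S : Matrix ι ι ℝ) :
    (multivariateGaussian 0 S).map (fun x => -x) = multivariateGaussian 0 S := by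
  unfold multivariateGaussian
  conv_rhs => rw [← map_neg_stdGaussian]
  rw [Measure.map_map (by fun_prop) (by fun_prop), Measure.map_map (by fun_prop) (by fun_prop)]
  congr 1
  ext x
  simp

/-- A function odd in an independent symmetric variable has zero integral. -/
theorem ProbabilityTheory.IndepFun.integral_eq_zero_of_odd {Ω α E : Type*} [MeasurableSpace Ω]
    [MeasurableSpace α] [MeasurableSpace E] [InvolutiveNeg E] [MeasurableNeg E]
    {P : Measure Ω} [IsFiniteMeasure P] {Y : Ω → α} {Z : Ω → E}
    (hYZ : IndepFun Y Z P) (hY : AEMeasurable Y P) (hZ : AEMeasurable Z P)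
    (hsymm : (P.map Z).map (fun z => -z) = P.map Z)
    {F : α × E → ℝ} (hF : Measurable F) (hodd : ∀ y z, F (y, -z) = -F (y, z)) :
    ∫ ω, F (Y ω, Z ω) ∂P = 0 := by
  have hlaw : P.map (fun ω => (Y ω, Z ω)) = (P.map Y).prod (P.map Z) :=
    (indepFun_iff_map_prod_eq_prod_map_map hY hZ).1 hYZ
  have hmap : ((P.map Y).prod (P.map Z)).map (Prod.map id fun z => -z) =
      (P.map Y).prod (P.map Z) := by
    rw [← Measure.map_prod_map _ _ measurable_id measurable_neg, hsymm, Measure.map_id]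
  have h1 : ∫ ω, F (Y ω, Z ω) ∂P = ∫ p, F p ∂((P.map Y).prod (P.map Z)) := by
    rw [← hlaw, integral_map (hY.prodMk hZ) hF.aestronglyMeasurable]
  have h2 : ∫ p, F p ∂((P.map Y).prod (P.map Z)) =
      -∫ p, F p ∂((P.map Y).prod (P.map Z)) := by
    conv_lhs => rw [← hmap]
    rw [integral_map (by fun_prop) hF.aestronglyMeasurable, ← integral_neg]
    exact integral_congr_ae (.of_forall fun p => hodd p.1 p.2)
  rw [h1]
  linarith

end Symmetry

section Masks

variable {d k : ℕ}

theorem continuous_hadamardProd :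
    Continuous fun p : EuclideanSpace ℝ (Fin d) × EuclideanSpace ℝ (Fin d) =>
      hadamardProd p.1 p.2 := by
  unfold hadamardProd
  fun_prop

theorem hadamardProd_neg (u v : EuclideanSpace ℝ (Fin d)) :
    hadamardProd u (-v) = -hadamardProd u v := by
  ext i
  simp [hadamardProd]

theorem norm_sq_hadamardProd (u v : EuclideanSpace ℝ (Fin d)) :
    ‖hadamardProd u v‖ ^ 2 = ∑ i, u i ^ 2 * v i ^ 2 := by
  simp [hadamardProd, EuclideanSpace.real_norm_sq_eq, mul_pow]

theorem finite_freezeMasks : (freezeMasks d k).Finite := by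
  have h : (Set.univ.pi fun _ : Fin d => ({0, 1} : Set ℝ)).Finite :=
    Set.Finite.pi fun _ => Set.toFinite _
  refine (h.image (WithLp.toLp 2)).subset fun m hm => ⟨m.ofLp, fun i _ => ?_, rfl⟩
  simpa using hm.1 i

theorem sq_le_one_of_mem_freezeMasks {m : EuclideanSpace ℝ (Fin d)} (hm : m ∈ freezeMasks d k)
    (i : Fin d) : m i ^ 2 ≤ 1 := by
  rcases hm.1 i with h | h <;> simp [h]

theorem sum_sq_of_mem_freezeMasks {m : EuclideanSpace ℝ (Fin d)} (hm : m ∈ freezeMasks d k) :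
    ∑ i, m i ^ 2 = k := by
  classical
  have h (i : Fin d) : m i ^ 2 = if m i = 1 then 1 else 0 := by
    rcases hm.1 i with h | h <;> simp [h]
  rw [Finset.sum_congr rfl fun i _ => h i, Finset.sum_boole, ← hm.2, Set.ncard_eq_toFinset_card']
  congr 2
  ext i
  simp

theorem norm_hadamardProd_le_of_mem_freezeMasks {m : EuclideanSpace ℝ (Fin d)}
    (hm : m ∈ freezeMasks d k) (z : EuclideanSpace ℝ (Fin d)) : ‖hadamardProd m z‖ ≤ ‖z‖ := by
  refine le_of_sq_le_sq ?_ (norm_nonneg z)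
  rw [norm_sq_hadamardProd, EuclideanSpace.real_norm_sq_eq]
  exact Finset.sum_le_sum fun i _ =>
    mul_le_of_le_one_left (sq_nonneg _) (sq_le_one_of_mem_freezeMasks hm i)

variable {Ω : Type*} [MeasurableSpace Ω] {P : Measure Ω} {m ζ : Ω → EuclideanSpace ℝ (Fin d)}

theorem ae_mem_freezeMasks (hm : HasLaw m (uniformOn (freezeMasks d k)) P) :
    ∀ᵐ ω ∂P, m ω ∈ freezeMasks d k := by
  have h : ∀ᵐ x ∂P.map m, x ∈ freezeMasks d k := by
    rw [hm.map_eq]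
    exact ae_cond_mem finite_freezeMasks.measurableSet
  exact ae_of_ae_map hm.aemeasurable h

theorem integral_sq_eval_of_hasLaw_multivariateGaussian {S : Matrix (Fin d) (Fin d) ℝ}
    (hS : S.PosSemidef) (hζ : HasLaw ζ (multivariateGaussian 0 S) P) (i : Fin d) :
    ∫ ω, ζ ω i ^ 2 ∂P = S i i := by
  have hmean : ∫ x : EuclideanSpace ℝ (Fin d), x i ∂multivariateGaussian 0 S = 0 := by
    have h := (EuclideanSpace.proj (𝕜 := ℝ) i).integral_comp_comm
      (IsGaussian.integrable_fun_id (μ := multivariateGaussian (0 : EuclideanSpace ℝ (Fin d)) S))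
    simpa using h
  rw [← variance_eval_multivariateGaussian (μ := 0) hS i,
    variance_of_integral_eq_zero (by fun_prop) hmean]
  exact hζ.integral_comp (f := fun x => x i ^ 2) (by fun_prop)

/-- Second moment of masked isotropic Gaussian noise. -/
theorem integral_norm_sq_hadamardProd [IsProbabilityMeasure P] {s : ℝ} (hs : 0 ≤ s)
    (hm : AEMeasurable m P) (hmask : ∀ᵐ ω ∂P, m ω ∈ freezeMasks d k)
    (hζ : HasLaw ζ (multivariateGaussian 0 (s • (1 : Matrix (Fin d) (Fin d) ℝ))) P)
    (hζ2 : MemLp ζ 2 P) (hindep : IndepFun m ζ P) :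
    ∫ ω, ‖hadamardProd (m ω) (ζ ω)‖ ^ 2 ∂P = s * k := by
  have hζi (i : Fin d) : Integrable (fun ω => ζ ω i ^ 2) P :=
    (hζ2.continuousLinearMap_comp (EuclideanSpace.proj (𝕜 := ℝ) i)).integrable_sq
  have hmi (i : Fin d) : Integrable (fun ω => m ω i ^ 2) P := by
    refine Integrable.of_bound (C := 1) (by fun_prop) ?_
    filter_upwards [hmask] with ω hω
    rw [Real.norm_of_nonneg (sq_nonneg _)]
    exact sq_le_one_of_mem_freezeMasks hω i
  have hi (i : Fin d) : IndepFun (fun ω => m ω i ^ 2) (fun ω => ζ ω i ^ 2) P :=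
    hindep.comp (φ := fun x : EuclideanSpace ℝ (Fin d) => x i ^ 2)
      (ψ := fun x : EuclideanSpace ℝ (Fin d) => x i ^ 2) (by fun_prop) (by fun_prop)
  have hS : (s • (1 : Matrix (Fin d) (Fin d) ℝ)).PosSemidef := Matrix.PosSemidef.one.smul hs
  simp_rw [norm_sq_hadamardProd]
  have hint (i : Fin d) : Integrable (fun ω => m ω i ^ 2 * ζ ω i ^ 2) P :=
    (hi i).integrable_mul (hmi i) (hζi i)
  rw [integral_finsetSum _ fun i _ => hint i]
  have hprod (i : Fin d) : ∫ ω, m ω i ^ 2 * ζ ω i ^ 2 ∂P = s * ∫ ω, m ω i ^ 2 ∂P := by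
    rw [(hi i).integral_fun_mul_eq_mul_integral (hmi i).aestronglyMeasurable
      (hζi i).aestronglyMeasurable, integral_sq_eval_of_hasLaw_multivariateGaussian hS hζ]
    simp [mul_comm]
  rw [Finset.sum_congr rfl fun i _ => hprod i, ← Finset.mul_sum,
    ← integral_finsetSum _ fun i _ => hmi i]
  congr 1
  rw [integral_congr_ae (hmask.mono fun ω hω => sum_sq_of_mem_freezeMasks hω)]
  simp

end Masks

theorem one_step_descent {d k B : ℕ} (hd : 1 ≤ d) (hk : k ≤ d) (hB : 1 ≤ B)
    (L : EuclideanSpace ℝ (Fin d) → ℝ) (G : ℝ≥0)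
    (hL : Differentiable ℝ L) (hG : LipschitzWith G (gradient L))
    (C σ γ : ℝ) (hC : 0 < C) (hγ : 0 < γ)
    {Ω : Type*} [MeasurableSpace Ω] (P : Measure Ω) [IsProbabilityMeasure P]
    (w g m ζ : Ω → EuclideanSpace ℝ (Fin d))
    (hw : AEMeasurable w P) (hg : AEMeasurable g P)
    (hclip : ∀ᵐ ω ∂P, ‖g ω‖ ≤ C)
    (hm : HasLaw m (uniformOn (freezeMasks d k)) P)
    (hζ : HasLaw ζ (multivariateGaussian 0 ((C ^ 2 * σ ^ 2) • (1 : Matrix (Fin d) (Fin d) ℝ))) P)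
    (hindep : IndepFun (fun ω => (w ω, g ω, m ω)) ζ P)
    (hint_inner : Integrable (fun ω => inner ℝ (gradient L (w ω)) (g ω)) P)
    (hint : Integrable (fun ω => L (w ω)) P)
    (hint' : Integrable (fun ω => L (freezeUpdate γ B (w ω) (g ω) (m ω) (ζ ω))) P) :
    ∫ ω, inner ℝ (gradient L (w ω)) (g ω) ∂P ≤
      ((∫ ω, L (w ω) ∂P) - ∫ ω, L (freezeUpdate γ B (w ω) (g ω) (m ω) (ζ ω)) ∂P) / γ +
        G * γ / 2 * (C ^ 2 + (1 - freezeRate d k) * (C ^ 2 * σ ^ 2 * d / B ^ 2)) := by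
  have hmask := ae_mem_freezeMasks hm
  have hmm := hm.aemeasurable
  have hζm := hζ.aemeasurable
  have hB0 : (B : ℝ) ≠ 0 := by positivity
  have hd0 : (d : ℝ) ≠ 0 := by positivity
  have hζ2 : MemLp ζ 2 P := by
    have h := IsGaussian.memLp_two_id (μ := multivariateGaussian (0 : EuclideanSpace ℝ (Fin d))
      ((C ^ 2 * σ ^ 2) • (1 : Matrix (Fin d) (Fin d) ℝ)))
    rw [← hζ.map_eq] at h
    exact h.comp_of_map hζm
  have hsymm : (P.map ζ).map (fun z => -z) = P.map ζ := by
    rw [hζ.map_eq, map_neg_multivariateGaussian_zero]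
  set N : Ω → EuclideanSpace ℝ (Fin d) := fun ω => hadamardProd (m ω) (ζ ω) with hN
  have hNm : AEMeasurable N P := continuous_hadamardProd.measurable.comp_aemeasurable
    (hmm.prodMk hζm)
  have hN2 : MemLp N 2 P := hζ2.mono hNm.aestronglyMeasurable
    (hmask.mono fun ω hω => norm_hadamardProd_le_of_mem_freezeMasks hω (ζ ω))
  have hg2 : MemLp g 2 P := MemLp.of_bound hg.aestronglyMeasurable C hclip
  have hgN : Integrable (fun ω => inner ℝ (g ω) (N ω)) P := by
    refine ((hN2.integrable one_le_two).norm.const_mul C).mono'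
      (hg.inner hNm).aestronglyMeasurable ?_
    filter_upwards [hclip] with ω hω
    exact (norm_inner_le_norm _ _).trans (by gcongr)
  have hNsq : Integrable (fun ω => ‖N ω‖ ^ 2) P := hN2.integrable_norm_pow (by norm_num)
  have hgsq : Integrable (fun ω => ‖g ω‖ ^ 2) P := hg2.integrable_norm_pow (by norm_num)
  have hEN : ∫ ω, ‖N ω‖ ^ 2 ∂P = C ^ 2 * σ ^ 2 * k :=
    integral_norm_sq_hadamardProd (by positivity) hmm hmask hζ hζ2
      (hindep.comp (measurable_snd.comp measurable_snd) measurable_id)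
  have hEg : ∫ ω, ‖g ω‖ ^ 2 ∂P ≤ C ^ 2 := by
    calc ∫ ω, ‖g ω‖ ^ 2 ∂P ≤ ∫ _, C ^ 2 ∂P :=
          integral_mono_ae hgsq (integrable_const _)
            (hclip.mono fun ω hω => pow_le_pow_left₀ (norm_nonneg _) hω 2)
      _ = C ^ 2 := by simp
  have hodd {φ : EuclideanSpace ℝ (Fin d) × EuclideanSpace ℝ (Fin d) × EuclideanSpace ℝ (Fin d) →
      EuclideanSpace ℝ (Fin d)} (hφ : Measurable φ) :
      ∫ ω, inner ℝ (φ (w ω, g ω, m ω)) (N ω) ∂P = 0 :=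
    hindep.integral_eq_zero_of_odd (hw.prodMk (hg.prodMk hmm)) hζm hsymm
      (F := fun p => inner ℝ (φ p.1) (hadamardProd p.1.2.2 p.2))
      ((hφ.comp measurable_fst).inner (continuous_hadamardProd.measurable.comp
        ((measurable_snd.comp (measurable_snd.comp measurable_fst)).prodMk measurable_snd)))
      fun y z => by simp only [hadamardProd_neg, inner_neg_right]
  have hEgN : ∫ ω, inner ℝ (g ω) (N ω) ∂P = 0 := hodd (measurable_fst.comp measurable_snd)
  have hEgradN : ∫ ω, inner ℝ (gradient L (w ω)) (N ω) ∂P = 0 :=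
    hodd (hG.continuous.measurable.comp measurable_fst)
  set Q : Ω → ℝ := fun ω => ‖g ω‖ ^ 2 + (2 / B * inner ℝ (g ω) (N ω) + 1 / B ^ 2 * ‖N ω‖ ^ 2)
    with hQ
  have hQint : Integrable Q P := hgsq.add ((hgN.const_mul _).add (hNsq.const_mul _))
  have hEQ : ∫ ω, Q ω ∂P ≤ C ^ 2 + C ^ 2 * σ ^ 2 * k / B ^ 2 := by
    simp only [hQ]
    rw [integral_add hgsq ((hgN.const_mul _).fun_add (hNsq.const_mul _)),
      integral_add (hgN.const_mul _) (hNsq.const_mul _), integral_const_mul, integral_const_mul,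
      hEgN, hEN]
    linarith [hEg, show 1 / (B : ℝ) ^ 2 * (C ^ 2 * σ ^ 2 * k) = C ^ 2 * σ ^ 2 * k / B ^ 2 by ring]
  set D : Ω → ℝ := fun ω => L (freezeUpdate γ B (w ω) (g ω) (m ω) (ζ ω)) - L (w ω) +
    γ * inner ℝ (gradient L (w ω)) (g ω) with hD
  have hDint : Integrable D P := (hint'.sub hint).add (hint_inner.const_mul γ)
  have hdesc (ω : Ω) : |D ω + γ / B * inner ℝ (gradient L (w ω)) (N ω)| ≤
      G * γ ^ 2 / 2 * Q ω := by
    have h := hG.abs_sub_sub_inner_gradient_le hL (w ω) (-(γ • (g ω + (1 / (B : ℝ)) • N ω)))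
    rw [norm_neg, norm_smul, mul_pow, norm_add_sq_real, norm_smul, inner_neg_right,
      real_inner_smul_right, real_inner_smul_right, inner_add_right, real_inner_smul_right, mul_pow,
      Real.norm_eq_abs, sq_abs, Real.norm_eq_abs, sq_abs, ← sub_eq_add_neg] at h
    convert h using 1
    · simp only [hD, hN, freezeUpdate]
      congr 1
      ring
    · simp only [hQ]
      ring
  have hgradN : Integrable (fun ω => inner ℝ (gradient L (w ω)) (N ω)) P := by
    have hmeas : AEStronglyMeasurable (fun ω => inner ℝ (gradient L (w ω)) (N ω)) P :=
      ((hG.continuous.measurable.comp_aemeasurable hw).inner hNm).aestronglyMeasurable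
    have hsum : Integrable (fun ω => D ω + γ / B * inner ℝ (gradient L (w ω)) (N ω)) P :=
      (hQint.const_mul (G * γ ^ 2 / 2)).mono' (hDint.aestronglyMeasurable.add (hmeas.const_mul _))
        (.of_forall hdesc)
    refine ((hsum.sub hDint).const_mul (B / γ)).congr (.of_forall fun ω => ?_)
    simp only [Pi.sub_apply]
    field_simp
    ring
  have hmain : ∫ ω, D ω ∂P ≤ G * γ ^ 2 / 2 * ∫ ω, Q ω ∂P := by
    have h := integral_mono (hDint.add (hgradN.const_mul (γ / B)))
      (hQint.const_mul (G * γ ^ 2 / 2)) fun ω => (le_abs_self _).trans (hdesc ω)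
    simp only [Pi.add_apply] at h
    rwa [integral_add hDint (hgradN.const_mul _), integral_const_mul, integral_const_mul, hEgradN,
      mul_zero, add_zero] at h
  have hED : ∫ ω, D ω ∂P = (∫ ω, L (freezeUpdate γ B (w ω) (g ω) (m ω) (ζ ω)) ∂P) -
      (∫ ω, L (w ω) ∂P) + γ * ∫ ω, inner ℝ (gradient L (w ω)) (g ω) ∂P := by
    rw [← integral_sub hint' hint, ← integral_const_mul]
    exact integral_add (hint'.sub hint) (hint_inner.const_mul γ)
  have hrate : (1 - freezeRate d k) * (C ^ 2 * σ ^ 2 * d / B ^ 2) =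
      C ^ 2 * σ ^ 2 * k / B ^ 2 := by
    rw [freezeRate]
    field_simp
    ring
  rw [hrate]
  have hfinal := hmain.trans (mul_le_mul_of_nonneg_left hEQ (by positivity))
  rw [hED] at hfinal
  refine le_of_mul_le_mul_left ?_ hγ
  rw [mul_add, mul_div_cancel₀ _ hγ.ne']
  linarith
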